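/- For every τ > 0 and x, k ∈ ℝ, the function σ ↦ Bac(τ, x, k, σ) is strictly increasing on (0, ∞), tends to max(x − k, 0) as σ → 0⁺, tends to +∞ as σ → +∞, and is a bijection from (0, ∞) onto the open interval (max(x − k, 0), +∞). In particular, for every price v ∈ (max(x − k, 0), +∞) there exists a unique implied Bachelier volatility σ > 0 with Bac(τ, x, k, σ) = v. -/

import Mathlib

open MeasureTheory Filter Set

/-- Standard normal density `φ(z) = e^{-z²/2}/√(2π)`. -/
noncomputable def stdGaussPdf (z : ℝ) : ℝ := Real.exp (-(z ^ 2) / 2) / Real.sqrt (2 * Real.pi)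

/-- Standard normal cumulative distribution function `Φ(z) = ∫_{-∞}^z φ(u) du`. -/
noncomputable def stdGaussCdf (z : ℝ) : ℝ := ∫ u in Set.Iic z, stdGaussPdf u

/-- `d(x, k, σ, τ) = (x − k)/(σ√τ)`. -/
noncomputable def dBac (x k σ τ : ℝ) : ℝ := (x - k) / (σ * Real.sqrt τ)

/-- Bachelier price `Bac(τ, x, k, σ) = (x − k)·Φ(d) + φ(d)·σ·√τ`. -/
noncomputable def Bac (τ x k σ : ℝ) : ℝ :=
  (x - k) * stdGaussCdf (dBac x k σ τ) + stdGaussPdf (dBac x k σ τ) * σ * Real.sqrt τ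

theorem pdf_pos (z : ℝ) : 0 < stdGaussPdf z := by
  unfold stdGaussPdf; positivity

theorem pdf_le (z : ℝ) : stdGaussPdf z ≤ stdGaussPdf 0 := by
  unfold stdGaussPdf
  gcongr ?_ / _
  apply Real.exp_le_exp.2
  nlinarith [sq_nonneg z]

theorem pdf_eq : stdGaussPdf = ProbabilityTheory.gaussianPDFReal 0 1 := by
  funext z
  simp [stdGaussPdf, ProbabilityTheory.gaussianPDFReal, div_eq_inv_mul]

theorem pdf_integrable : Integrable stdGaussPdf := by
  rw [pdf_eq]; exact ProbabilityTheory.integrable_gaussianPDFReal 0 1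

theorem pdf_integral : ∫ u, stdGaussPdf u = 1 := by
  rw [pdf_eq]; exact ProbabilityTheory.integral_gaussianPDFReal_eq_one 0 (by simp)

theorem pdf_hasDerivAt (z : ℝ) : HasDerivAt stdGaussPdf (-z * stdGaussPdf z) z := by
  unfold stdGaussPdf
  have h : HasDerivAt (fun z : ℝ => -(z ^ 2) / 2) (-z) z := by
    have := (((hasDerivAt_id z).pow 2).neg).div_const 2
    refine HasDerivAt.congr_deriv this ?_
    simp
    ring
  have := h.exp.div_const (Real.sqrt (2 * Real.pi))
  refine HasDerivAt.congr_deriv this ?_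
  ring

theorem pdf_cont : Continuous stdGaussPdf := by
  unfold stdGaussPdf; fun_prop

theorem cdf_eq (z : ℝ) : stdGaussCdf z = stdGaussCdf 0 + ∫ u in (0 : ℝ)..z, stdGaussPdf u := by
  have := intervalIntegral.integral_Iic_sub_Iic (μ := volume) (f := stdGaussPdf) (a := 0) (b := z)
    pdf_integrable.integrableOn pdf_integrable.integrableOn
  rw [← this]; unfold stdGaussCdf; ring

theorem cdf_hasDerivAt (z : ℝ) : HasDerivAt stdGaussCdf (stdGaussPdf z) z := by
  have h : HasDerivAt (fun z => ∫ u in (0 : ℝ)..z, stdGaussPdf u) (stdGaussPdf z) z :=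
    (pdf_cont.integral_hasStrictDerivAt 0 z).hasDerivAt
  rw [show stdGaussCdf = _ from funext cdf_eq]
  exact h.const_add _

theorem cdf_atTop : Tendsto stdGaussCdf atTop (nhds 1) := by
  rw [← pdf_integral]
  exact (aecover_Iic tendsto_id).integral_tendsto_of_countably_generated pdf_integrable

theorem cdf_atBot : Tendsto stdGaussCdf atBot (nhds 0) := by
  have h := intervalIntegral_tendsto_integral_Iic (μ := volume) (f := stdGaussPdf) 0
    pdf_integrable.integrableOn (tendsto_id (α := ℝ) (x := atBot))
  have h2 := h.const_sub (stdGaussCdf 0)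
  have e : stdGaussCdf 0 - ∫ u in Set.Iic (0 : ℝ), stdGaussPdf u = 0 := sub_self _
  rw [e] at h2
  refine h2.congr fun z => ?_
  rw [cdf_eq z, intervalIntegral.integral_symm]
  simp

theorem bac_hasDerivAt (τ x k σ : ℝ) (hτ : 0 < τ) (hσ : 0 < σ) :
    HasDerivAt (fun σ => Bac τ x k σ) (stdGaussPdf (dBac x k σ τ) * Real.sqrt τ) σ := by
  have hs : 0 < Real.sqrt τ := Real.sqrt_pos.2 hτ
  have hd : HasDerivAt (fun σ => dBac x k σ τ) (-(dBac x k σ τ) / σ) σ := by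
    unfold dBac
    have := (hasDerivAt_const σ (x - k)).fun_div ((hasDerivAt_id' σ).mul_const (Real.sqrt τ))
      (by positivity)
    refine HasDerivAt.congr_deriv this ?_
    field_simp
    ring
  have h1 := ((cdf_hasDerivAt (dBac x k σ τ)).comp σ hd).const_mul (x - k)
  have h2 := ((((pdf_hasDerivAt (dBac x k σ τ)).comp σ hd).mul (hasDerivAt_id' σ)).mul_const
    (Real.sqrt τ))
  have h3 := h1.add h2
  unfold Bac
  refine HasDerivAt.congr_deriv h3 ?_
  have e : x - k = dBac x k σ τ * (σ * Real.sqrt τ) := by unfold dBac; field_simp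
  simp only [Function.comp]
  generalize dBac x k σ τ = d at *
  rw [e]
  field_simp
  ring

theorem bac_strictMono (τ x k : ℝ) (hτ : 0 < τ) :
    StrictMonoOn (fun σ => Bac τ x k σ) (Set.Ioi 0) := by
  refine strictMonoOn_of_deriv_pos (convex_Ioi 0)
    (fun σ hσ => (bac_hasDerivAt τ x k σ hτ hσ).continuousAt.continuousWithinAt) ?_
  intro σ hσ
  rw [interior_Ioi] at hσ
  rw [(bac_hasDerivAt τ x k σ hτ hσ).deriv]
  exact mul_pos (pdf_pos _) (Real.sqrt_pos.2 hτ)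

theorem bac_zero (τ x k : ℝ) (hτ : 0 < τ) :
    Tendsto (fun σ => Bac τ x k σ) (nhdsWithin 0 (Set.Ioi 0)) (nhds (max (x - k) 0)) := by
  have hs : 0 < Real.sqrt τ := Real.sqrt_pos.2 hτ
  have hinv : Tendsto (fun σ : ℝ => (σ * Real.sqrt τ)⁻¹) (nhdsWithin 0 (Set.Ioi 0)) atTop := by
    simp only [mul_inv]
    exact tendsto_inv_nhdsGT_zero.atTop_mul_const (inv_pos.2 hs)
  have h2 : Tendsto (fun σ => stdGaussPdf (dBac x k σ τ) * σ * Real.sqrt τ)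
      (nhdsWithin 0 (Set.Ioi 0)) (nhds 0) := by
    have hb : Tendsto (fun σ : ℝ => stdGaussPdf 0 * σ * Real.sqrt τ)
        (nhdsWithin 0 (Set.Ioi 0)) (nhds 0) := by
      have : Continuous (fun σ : ℝ => stdGaussPdf 0 * σ * Real.sqrt τ) := by fun_prop
      have := this.tendsto 0
      simp only [mul_zero, zero_mul] at this
      exact this.mono_left nhdsWithin_le_nhds
    refine tendsto_of_tendsto_of_tendsto_of_le_of_le' tendsto_const_nhds hb ?_ ?_
    · filter_upwards [self_mem_nhdsWithin] with σ hσ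
      have : (0 : ℝ) < σ := hσ
      have := pdf_pos (dBac x k σ τ)
      positivity
    · filter_upwards [self_mem_nhdsWithin] with σ hσ
      have : (0 : ℝ) < σ := hσ
      have := pdf_le (dBac x k σ τ)
      gcongr
  have h1 : Tendsto (fun σ => (x - k) * stdGaussCdf (dBac x k σ τ))
      (nhdsWithin 0 (Set.Ioi 0)) (nhds (max (x - k) 0)) := by
    rcases lt_trichotomy (x - k) 0 with h | h | h
    · rw [max_eq_right h.le]
      have hd : Tendsto (fun σ => dBac x k σ τ) (nhdsWithin 0 (Set.Ioi 0)) atBot := by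
        simp only [dBac, div_eq_mul_inv]
        exact hinv.const_mul_atTop_of_neg h
      simpa using (cdf_atBot.comp hd).const_mul (x - k)
    · simp [h]
    · rw [max_eq_left h.le]
      have hd : Tendsto (fun σ => dBac x k σ τ) (nhdsWithin 0 (Set.Ioi 0)) atTop := by
        simp only [dBac, div_eq_mul_inv]
        exact hinv.const_mul_atTop h
      simpa using (cdf_atTop.comp hd).const_mul (x - k)
  simpa [Bac] using h1.add h2

theorem bac_top (τ x k : ℝ) (hτ : 0 < τ) : Tendsto (fun σ => Bac τ x k σ) atTop atTop := by
  have hs : 0 < Real.sqrt τ := Real.sqrt_pos.2 hτ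
  have hd : Tendsto (fun σ => dBac x k σ τ) atTop (nhds 0) := by
    unfold dBac
    exact (tendsto_id.atTop_mul_const hs).const_div_atTop (x - k)
  have h1 := (((cdf_hasDerivAt 0).continuousAt.tendsto).comp hd).const_mul (x - k)
  have h2 := ((((pdf_cont.tendsto 0).comp hd).pos_mul_atTop (pdf_pos 0) tendsto_id)).atTop_mul_const hs
  exact h1.add_atTop h2

/-- For every τ > 0 and x, k ∈ ℝ, the map `σ ↦ Bac(τ, x, k, σ)` is
strictly increasing on (0, ∞), tends to `max (x − k) 0` as σ → 0⁺, tends to +∞ as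
σ → +∞, and is a bijection from (0, ∞) onto (max (x − k) 0, ∞); in particular every
price `v` in that interval admits a unique implied Bachelier volatility. -/
theorem bachelier_implied_vol_exists_unique (τ x k : ℝ) (hτ : 0 < τ) :
    StrictMonoOn (fun σ => Bac τ x k σ) (Set.Ioi 0) ∧
    Tendsto (fun σ => Bac τ x k σ) (nhdsWithin 0 (Set.Ioi 0)) (nhds (max (x - k) 0)) ∧
    Tendsto (fun σ => Bac τ x k σ) atTop atTop ∧
    Set.BijOn (fun σ => Bac τ x k σ) (Set.Ioi 0) (Set.Ioi (max (x - k) 0)) ∧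
    ∀ v ∈ Set.Ioi (max (x - k) 0), ∃! σ : ℝ, 0 < σ ∧ Bac τ x k σ = v := by
  have hm := bac_strictMono τ x k hτ
  have h0 := bac_zero τ x k hτ
  have ht := bac_top τ x k hτ
  have hb : Set.BijOn (fun σ => Bac τ x k σ) (Set.Ioi 0) (Set.Ioi (max (x - k) 0)) := by
    refine ⟨?_, hm.injOn, ?_⟩
    · intro σ hσ
      have hσ' : (0 : ℝ) < σ := hσ
      have h2 : σ / 2 ∈ Set.Ioi (0 : ℝ) := half_pos hσ'
      refine lt_of_le_of_lt ?_ (hm h2 hσ (half_lt_self hσ'))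
      refine le_of_tendsto h0 ?_
      filter_upwards [Ioo_mem_nhdsGT (half_pos hσ')] with s hs
      exact (hm hs.1 h2 hs.2).le
    · exact isPreconnected_Ioi.intermediate_value_Ioi
        (le_principal_iff.2 self_mem_nhdsWithin) (le_principal_iff.2 (Ioi_mem_atTop 0))
        (fun σ hσ => (bac_hasDerivAt τ x k σ hτ hσ).continuousAt.continuousWithinAt) h0 ht
  refine ⟨hm, h0, ht, hb, fun v hv => ?_⟩
  obtain ⟨σ, hσ, rfl⟩ := hb.surjOn hv
  exact ⟨σ, ⟨hσ, rfl⟩, fun s hs => hb.injOn hs.1 hσ hs.2⟩
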